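/- arXiv:2405.08709 — 3 statements merged into one kernel-verified Lean document; each statement's English description precedes it below -/
import Mathlib

section
/- Let S1, S2, Y be random variables on a probability space with values in nonempty finite sets, write S = (S1,S2), and let ε satisfy 0 ≤ ε < I(S;Y) and ε ≤ H(S2) with H(S2) > 0; set α2 = ε/H(S2). Then there exist a probability space carrying random variables S1', S2', Y' whose joint distribution equals that of (S1,S2,Y) and a finite-valued random variable U such that I(U;(S1',S2')) ≤ ε and I(U;Y') ≥ H(Y|S) + ε − α2·H(S|Y) − (1−α2)·(log(I(S;Y)+1) + 4), where log is base 2. This establishes, for a fixed representation S=(S1,S2), the lower bound L_h^4(ε) of Theorem 1. -/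
open MeasureTheory ProbabilityTheory Real

noncomputable section

/-- The probability mass function of a random variable `X` under the measure `μ`. -/
def pm {Ω : Type*} [MeasurableSpace Ω] (μ : Measure Ω) {𝒳 : Type*} (X : Ω → 𝒳) (x : 𝒳) : ℝ :=
  (μ (X ⁻¹' {x})).toReal

/-- Shannon entropy (base 2) of a finite-valued random variable. -/
def ent {Ω : Type*} [MeasurableSpace Ω] (μ : Measure Ω) {𝒳 : Type*} [Fintype 𝒳]
    (X : Ω → 𝒳) : ℝ :=
  -∑ x, pm μ X x * Real.logb 2 (pm μ X x)

/-- Conditional entropy `H(X|Y) = H(X,Y) - H(Y)` (base 2). -/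
def condEnt {Ω : Type*} [MeasurableSpace Ω] (μ : Measure Ω) {𝒳 𝒴 : Type*} [Fintype 𝒳]
    [Fintype 𝒴] (X : Ω → 𝒳) (Y : Ω → 𝒴) : ℝ :=
  ent μ (fun ω => (X ω, Y ω)) - ent μ Y

/-- Mutual information `I(X;Y) = H(X) + H(Y) - H(X,Y)` (base 2). -/
def mi {Ω : Type*} [MeasurableSpace Ω] (μ : Measure Ω) {𝒳 𝒴 : Type*} [Fintype 𝒳]
    [Fintype 𝒴] (X : Ω → 𝒳) (Y : Ω → 𝒴) : ℝ :=
  ent μ X + ent μ Y - ent μ (fun ω => (X ω, Y ω))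

/-- Conditional mutual information `I(X;Y|Z) = H(X|Z) + H(Y|Z) - H((X,Y)|Z)` (base 2). -/
def condMI {Ω : Type*} [MeasurableSpace Ω] (μ : Measure Ω) {𝒳 𝒴 𝒵 : Type*} [Fintype 𝒳]
    [Fintype 𝒴] [Fintype 𝒵] (X : Ω → 𝒳) (Y : Ω → 𝒴) (Z : Ω → 𝒵) : ℝ :=
  condEnt μ X Z + condEnt μ Y Z - condEnt μ (fun ω => (X ω, Y ω)) Z

/-- The standard exponential distribution on the real line. -/
def stdExp : Measure ℝ :=
  (volume.restrict (Set.Ioi 0)).withDensity fun t => ENNReal.ofReal (rexp (-t))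

lemma lintegral_stdExp {h : ℝ → ENNReal} (hh : Measurable h) :
    ∫⁻ t, h t ∂stdExp = ∫⁻ t in Set.Ioi 0, h t * ENNReal.ofReal (rexp (-t)) := by
  rw [stdExp, lintegral_withDensity_eq_lintegral_mul _ (by fun_prop) hh]
  simp [mul_comm]

lemma lintegral_exp_neg_Ioi (c : ℝ) :
    ∫⁻ t in Set.Ioi c, ENNReal.ofReal (rexp (-t)) = ENNReal.ofReal (rexp (-c)) := by
  rw [← integral_exp_neg_Ioi c, ofReal_integral_eq_lintegral_ofReal]
  · simpa [IntegrableOn] using integrableOn_exp_mul_Ioi (a := -1) (by norm_num) c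
  · exact ae_of_all _ fun _ => (exp_pos _).le

instance isProbabilityMeasure_stdExp : IsProbabilityMeasure stdExp := by
  constructor
  rw [← lintegral_one, lintegral_stdExp measurable_const]
  simpa using lintegral_exp_neg_Ioi 0

lemma stdExp_Ici_le (c : ℝ) : stdExp (Set.Ici c) ≤ ENNReal.ofReal (rexp (-c)) := by
  rw [← lintegral_exp_neg_Ioi c, stdExp, withDensity_apply _ measurableSet_Ici,
    Measure.restrict_restrict measurableSet_Ici, ← Measure.restrict_congr_set Ioi_ae_eq_Ici.symm]
  exact lintegral_mono_set Set.inter_subset_left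

lemma stdExp_ae_pos : ∀ᵐ t ∂stdExp, 0 < t :=
  (withDensity_absolutelyContinuous _ _).ae_le (ae_restrict_mem measurableSet_Ioi)

/-- In a race between independent exponential clocks run at rates `w`, this bounds the
integral of a function of the clock `i` over the event that it rings first. -/
lemma lintegral_race_le {n : ℕ} {w : Fin (n + 1) → ℝ} (hw : ∀ i, 0 ≤ w i) (hw1 : ∑ i, w i = 1)
    {i : Fin (n + 1)} (hi : 0 < w i) {h : ℝ → ENNReal} (hh : Measurable h) :
    ∫⁻ e in {e : Fin (n + 1) → ℝ | ∀ j, 0 < w j → e i / w i ≤ e j / w j}, h (e i)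
        ∂(Measure.pi fun _ => stdExp)
      ≤ ∫⁻ t in Set.Ioi 0, h t * ENNReal.ofReal (rexp (-(t / w i))) := by
  classical
  have hmp := measurePreserving_piFinSuccAbove (fun _ : Fin (n + 1) => stdExp) i
  set B : Set (ℝ × (Fin n → ℝ)) :=
    {q | ∀ j, 0 < w (i.succAbove j) → q.1 / w i ≤ q.2 j / w (i.succAbove j)} with hB
  have hBm : MeasurableSet B := by
    simp only [hB, Set.ofPred_forall]
    refine MeasurableSet.iInter fun j => MeasurableSet.iInter fun _ => ?_
    exact measurableSet_le (by fun_prop) (by fun_prop)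
  have hA : {e : Fin (n + 1) → ℝ | ∀ j, 0 < w j → e i / w i ≤ e j / w j}
      = MeasurableEquiv.piFinSuccAbove (fun _ : Fin (n + 1) => ℝ) i ⁻¹' B := by
    ext e
    simp only [hB, Set.mem_ofPred_eq, Set.mem_preimage]
    constructor
    · intro H j hj
      exact H _ hj
    · intro H j hj
      rcases Fin.eq_self_or_eq_succAbove i j with rfl | ⟨k, rfl⟩
      · exact le_rfl
      · exact H k hj
  have hg : Measurable (B.indicator fun q : ℝ × (Fin n → ℝ) => h q.1) :=
    (hh.comp measurable_fst).indicator hBm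
  have hslice : ∀ t : ℝ, 0 < t → (Measure.pi fun _ : Fin n => stdExp) {x | (t, x) ∈ B}
      ≤ ENNReal.ofReal (rexp (t - t / w i)) := by
    intro t ht
    have hset : {x | (t, x) ∈ B} = Set.univ.pi fun j =>
        {x : ℝ | 0 < w (i.succAbove j) → t / w i ≤ x / w (i.succAbove j)} := by
      ext x
      simp [hB]
    have hsum : ∑ j, w (i.succAbove j) = 1 - w i := by
      rw [← hw1, Fin.sum_univ_succAbove w i]
      ring
    have hexp : t - t / w i = ∑ j, -(w (i.succAbove j) * (t / w i)) := by
      rw [Finset.sum_neg_distrib, ← Finset.sum_mul, hsum]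
      field_simp
      ring
    rw [hset, Measure.pi_pi, hexp, Real.exp_sum,
      ENNReal.ofReal_prod_of_nonneg fun _ _ => (exp_pos _).le]
    refine Finset.prod_le_prod' fun j _ => ?_
    rcases (hw (i.succAbove j)).eq_or_lt with h0 | h0
    · simp [← h0]
    · have : {x : ℝ | 0 < w (i.succAbove j) → t / w i ≤ x / w (i.succAbove j)}
          = Set.Ici (w (i.succAbove j) * (t / w i)) := by
        ext x
        simp [h0, le_div_iff₀ h0, mul_comm]
      rw [this]
      exact stdExp_Ici_le _
  calc _ = ∫⁻ e, B.indicator (fun q => h q.1)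
          (MeasurableEquiv.piFinSuccAbove (fun _ : Fin (n + 1) => ℝ) i e)
          ∂(Measure.pi fun _ => stdExp) := by
        rw [hA, ← lintegral_indicator ((MeasurableEquiv.measurable _) hBm)]
        rfl
    _ = ∫⁻ q, B.indicator (fun q => h q.1) q ∂(stdExp.prod (Measure.pi fun _ => stdExp)) :=
        hmp.lintegral_comp_emb (MeasurableEquiv.measurableEmbedding _) _
    _ = ∫⁻ t, h t * (Measure.pi fun _ : Fin n => stdExp) {x | (t, x) ∈ B} ∂stdExp := by
        rw [lintegral_prod _ hg.aemeasurable]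
        refine lintegral_congr fun t => ?_
        have hm : MeasurableSet {x | (t, x) ∈ B} := measurable_prodMk_left hBm
        rw [← lintegral_indicator_const hm]
        rfl
    _ ≤ ∫⁻ t, h t * ENNReal.ofReal (rexp (t - t / w i)) ∂stdExp := by
        refine lintegral_mono_ae ?_
        filter_upwards [stdExp_ae_pos] with t ht
        gcongr
        exact hslice t ht
    _ = _ := by
        rw [lintegral_stdExp (by fun_prop)]
        refine lintegral_congr fun t => ?_
        rw [mul_assoc, ← ENNReal.ofReal_mul (exp_pos _).le, ← Real.exp_add]
        congr 3
        ring

/-- Exponential clocks indexed by an arbitrary finite type. -/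
lemma exists_race (𝒴 : Type*) [Fintype 𝒴] [Nonempty 𝒴] :
    ∃ (E : Type) (_ : MeasurableSpace E) (ν : Measure E), IsProbabilityMeasure ν ∧
    ∃ T : 𝒴 → E → ℝ, (∀ y, Measurable (T y)) ∧ (∀ᵐ e ∂ν, ∀ y, 0 ≤ T y e) ∧
      (∀ (h : ℝ → ENNReal), Measurable h → ∀ y,
        ∫⁻ e, h (T y e) ∂ν ≤ ∫⁻ t in Set.Ioi 0, h t) ∧
      ∀ w : 𝒴 → ℝ, (∀ y, 0 ≤ w y) → ∑ y, w y = 1 → ∀ y, 0 < w y →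
        ∀ h : ℝ → ENNReal, Measurable h →
        ∫⁻ e in {e | ∀ j, 0 < w j → T y e / w y ≤ T j e / w j}, h (T y e) ∂ν
          ≤ ∫⁻ t in Set.Ioi 0, h t * ENNReal.ofReal (rexp (-(t / w y))) := by
  obtain ⟨n, hn⟩ : ∃ n, Fintype.card 𝒴 = n + 1 :=
    Nat.exists_eq_succ_of_ne_zero Fintype.card_ne_zero
  have φ : 𝒴 ≃ Fin (n + 1) := Fintype.equivFinOfCardEq hn
  refine ⟨Fin (n + 1) → ℝ, inferInstance, Measure.pi fun _ => stdExp, inferInstance,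
    fun y e => e (φ y), fun y => measurable_pi_apply _, ?_, fun h hh y => ?_,
    fun w hw hw1 y hy h hh => ?_⟩
  · refine ae_all_iff.2 fun y => ?_
    have := (measurePreserving_eval (fun _ : Fin (n + 1) => stdExp) (φ y)).quasiMeasurePreserving.ae
      stdExp_ae_pos
    filter_upwards [this] with e he using le_of_lt he
  · rw [(measurePreserving_eval (fun _ : Fin (n + 1) => stdExp) (φ y)).lintegral_comp hh,
      lintegral_stdExp hh]
    refine lintegral_mono_ae ?_
    filter_upwards [ae_restrict_mem measurableSet_Ioi] with t ht
    refine mul_le_of_le_one_right' ?_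
    rw [ENNReal.ofReal_le_one, Real.exp_le_one_iff]
    simpa using le_of_lt ht
  · have := lintegral_race_le (w := w ∘ φ.symm) (fun i => hw _)
      (by simpa using (Equiv.sum_comp φ.symm w).trans hw1) (i := φ y) (by simpa using hy) hh
    convert this using 4
    · ext e
      constructor
      · intro H j hj
        simpa using H (φ.symm j) hj
      · intro H j hj
        simpa using H (φ j) (by simpa using hj)
    · simp

lemma lintegral_exp_neg_div {w : ℝ} (hw : 0 < w) :
    ∫⁻ t in Set.Ioi 0, ENNReal.ofReal (rexp (-(t / w))) = ENNReal.ofReal w := by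
  have e : ∀ t : ℝ, rexp (-(t / w)) = rexp (-w⁻¹ * t) := fun t => by congr 1; ring
  have hneg : -w⁻¹ < 0 := by simpa using hw
  simp_rw [e]
  rw [← ofReal_integral_eq_lintegral_ofReal (integrableOn_exp_mul_Ioi hneg 0)
    (ae_of_all _ fun _ => (exp_pos _).le), integral_exp_mul_Ioi hneg]
  simp

lemma lintegral_mul_exp_neg_div {w : ℝ} (hw : 0 < w) :
    ∫⁻ t in Set.Ioi 0, ENNReal.ofReal t * ENNReal.ofReal (rexp (-(t / w)))
      = ENNReal.ofReal (w ^ 2) := by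
  have e : ∀ t ∈ Set.Ioi (0 : ℝ), ENNReal.ofReal t * ENNReal.ofReal (rexp (-(t / w)))
      = ENNReal.ofReal (t ^ ((2 : ℝ) - 1) * rexp (-(w⁻¹ * t))) := fun t ht => by
    rw [← ENNReal.ofReal_mul (le_of_lt ht)]
    norm_num
    congr 3
    ring
  rw [setLIntegral_congr_fun measurableSet_Ioi e, ← ofReal_integral_eq_lintegral_ofReal,
    Real.integral_rpow_mul_exp_neg_mul_Ioi (by norm_num) (by positivity)]
  · simp
  · by_contra hcon
    have := Real.integral_rpow_mul_exp_neg_mul_Ioi (a := 2) (r := w⁻¹) (by norm_num) (by positivity)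
    rw [integral_undef hcon] at this
    have : (0 : ℝ) < (1 / w⁻¹) ^ (2 : ℝ) * Gamma 2 := by
      have := Real.Gamma_pos_of_pos (s := 2) (by norm_num)
      positivity
    linarith
  · filter_upwards [ae_restrict_mem measurableSet_Ioi] with t ht
    have : (0 : ℝ) ≤ t := le_of_lt ht
    positivity

lemma lintegral_lomax {σ q : ℝ} (hσ : 0 < σ) (hq : 0 < q) :
    ∫⁻ t in Set.Ioi 0, ENNReal.ofReal (σ * (1 + t / q) ^ (-σ - 1)) = ENNReal.ofReal q := by
  have hd : ∀ x ∈ Set.Ici (0 : ℝ),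
      HasDerivAt (fun t => -q * (1 + t / q) ^ (-σ)) (σ * (1 + x / q) ^ (-σ - 1)) x := by
    intro x hx
    have hx : (0 : ℝ) ≤ x := hx
    have h1 : HasDerivAt (fun t : ℝ => 1 + t / q) (1 / q) x :=
      ((hasDerivAt_id x).div_const q).const_add 1
    refine ((h1.rpow_const (p := -σ) (Or.inl (by positivity))).const_mul (-q)).congr_deriv ?_
    field_simp
  have hpos : ∀ x ∈ Set.Ioi (0 : ℝ), 0 ≤ σ * (1 + x / q) ^ (-σ - 1) := fun x hx => by
    have : (0 : ℝ) ≤ x := le_of_lt hx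
    positivity
  have hlim : Filter.Tendsto (fun t : ℝ => -q * (1 + t / q) ^ (-σ)) Filter.atTop (nhds 0) := by
    have h1 : Filter.Tendsto (fun t : ℝ => 1 + t / q) Filter.atTop Filter.atTop :=
      Filter.tendsto_atTop_add_const_left _ _ (Filter.tendsto_id.atTop_div_const hq)
    simpa using ((tendsto_rpow_neg_atTop hσ).comp h1).const_mul (-q)
  rw [← ofReal_integral_eq_lintegral_ofReal (integrableOn_Ioi_deriv_of_nonneg' hd hpos hlim)
    ((ae_restrict_mem measurableSet_Ioi).mono hpos),
    integral_Ioi_of_hasDerivAt_of_nonneg' hd hpos hlim]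
  simp

/-- A finite measurable cover of a measurable space has a measurable selection. -/
lemma exists_measurable_selection {E 𝒴 : Type*} [MeasurableSpace E] [Finite 𝒴]
    (A : 𝒴 → Set E) (hA : ∀ y, MeasurableSet (A y)) (hcov : ∀ e, ∃ y, e ∈ A y) :
    ∃ f : E → 𝒴, (∀ y, MeasurableSet {e | f e = y}) ∧ ∀ e, e ∈ A (f e) := by
  classical
  obtain ⟨n, ⟨φ⟩⟩ := Finite.exists_equiv_fin 𝒴
  have hp : ∀ e, ∃ k, ∃ y, (φ y : ℕ) = k ∧ e ∈ A y := fun e =>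
    let ⟨y, hy⟩ := hcov e
    ⟨_, y, rfl, hy⟩
  have hm : Measurable fun e => Nat.find (hp e) := measurable_find hp fun k => by
    simp only [Set.ofPred_exists, Set.ofPred_and]
    exact MeasurableSet.iUnion fun y => (MeasurableSet.const _).inter (hA y)
  choose f hf using fun e => Nat.find_spec (hp e)
  refine ⟨f, fun y => ?_, fun e => (hf e).2⟩
  have : {e | f e = y} = (fun e => Nat.find (hp e)) ⁻¹' {(φ y : ℕ)} := by
    ext e
    rw [Set.mem_preimage, ← (hf e).1]
    simp [Fin.val_inj]
  rw [this]
  exact hm (measurableSet_singleton _)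

lemma negMulLog_le_cross {P φ : ℝ} (hP : 0 ≤ P) (hφ : 0 < φ) :
    negMulLog P ≤ P * -log φ + φ - P := by
  rcases hP.eq_or_lt with rfl | hP
  · simpa using hφ.le
  · have h := mul_le_mul_of_nonneg_left (Real.log_le_sub_one_of_pos (div_pos hφ hP)) hP.le
    rw [Real.log_div hφ.ne' hP.ne', mul_sub, mul_sub, mul_div_cancel₀ _ hP.ne'] at h
    rw [negMulLog]
    linarith

lemma log_one_add_le_affine {R x : ℝ} (hR : 0 ≤ R) (hx : 0 ≤ x) :
    log (1 + x) ≤ log (1 + R) - R / (1 + R) + x / (1 + R) := by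
  have h := Real.log_le_sub_one_of_pos (show 0 < (1 + x) / (1 + R) by positivity)
  rw [Real.log_div (by positivity) (by positivity)] at h
  have : (1 + x) / (1 + R) - 1 = -(R / (1 + R)) + x / (1 + R) := by
    field_simp
    ring
  linarith

lemma log_one_add_le_log_add {R : ℝ} (hR : 0 < R) :
    log (1 + R) ≤ log R + log 2 + (R⁻¹ - 1) / 2 := by
  have h := Real.log_le_sub_one_of_pos (show 0 < (1 + R) / (R * 2) by positivity)
  rw [Real.log_div (by positivity) (by positivity), Real.log_mul hR.ne' (by norm_num)] at h
  have : (1 + R) / (R * 2) - 1 = (R⁻¹ - 1) / 2 := by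
    field_simp
    ring
  linarith

lemma neg_log_lomax_le {σ q R t : ℝ} (hσ : 0 < σ) (hq : 0 < q) (hR : 0 ≤ R) (ht : 0 ≤ t) :
    -log (σ * (1 + t / q) ^ (-σ - 1)) ≤
      -log σ + (1 + σ) * (log (1 + R) - R / (1 + R) + t / q / (1 + R)) := by
  have h1 : 0 < 1 + t / q := by positivity
  rw [Real.log_mul hσ.ne' (by positivity), Real.log_rpow h1]
  have := mul_le_mul_of_nonneg_left (log_one_add_le_affine hR (div_nonneg ht hq.le))
    (by linarith : (0 : ℝ) ≤ 1 + σ)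
  linarith

/-- The law of a random element of a finite type, and expectations with respect to it. -/
lemma integral_comp_eq_sum {E α : Type*} [MeasurableSpace E] [Fintype α] (ν : Measure E)
    [IsProbabilityMeasure ν] {F : E → α} (hF : ∀ a, MeasurableSet {e | F e = a}) (g : α → ℝ) :
    Integrable (fun e => g (F e)) ν ∧
      ∫ e, g (F e) ∂ν = ∑ a, ν.real {e | F e = a} * g a := by
  classical
  have hg : (fun e => g (F e)) = fun e => ∑ a, {e | F e = a}.indicator (fun _ => g a) e := by
    ext e
    simp [Set.indicator_apply]
  have hi : ∀ a ∈ Finset.univ, Integrable ({e | F e = a}.indicator fun _ => g a) ν :=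
    fun a _ => (integrable_const _).indicator (hF a)
  rw [hg]
  refine ⟨integrable_finsetSum _ hi, ?_⟩
  rw [integral_finsetSum _ hi]
  exact Finset.sum_congr rfl fun a _ => by rw [integral_indicator_const _ (hF a), smul_eq_mul]

lemma entropy_fiber_le {𝒮 𝒴 : Type*} [Fintype 𝒮] [Fintype 𝒴] [DecidableEq 𝒴]
    {p : 𝒮 → ℝ} {w : 𝒮 → 𝒴 → ℝ} (hp : ∀ s, 0 ≤ p s) (hp1 : ∑ s, p s = 1)
    (hw : ∀ s y, 0 ≤ w s y) {σ : ℝ} (hσ : 0 < σ) {q : 𝒴 → ℝ} (hq : ∀ y, q y = ∑ s, p s * w s y)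
    {f : 𝒮 → 𝒴} (hf : ∀ s, 0 < w s (f s)) {T : 𝒴 → ℝ} (hT : ∀ y, 0 ≤ T y) :
    ∑ y, negMulLog (∑ s, if f s = y then p s else 0) ≤
      -log σ + (1 + σ) * ∑ s, p s * (log (1 + w s (f s) / q (f s))
          - w s (f s) / q (f s) / (1 + w s (f s) / q (f s))
          + T (f s) / q (f s) / (1 + w s (f s) / q (f s)))
        + (∑ y, if 0 < q y then σ * (1 + T y / q y) ^ (-σ - 1) else 0) - 1 := by
  have hq0 : ∀ y, 0 ≤ q y := fun y => by
    rw [hq]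
    exact Finset.sum_nonneg fun s _ => mul_nonneg (hp s) (hw s y)
  have hqpos : ∀ s, 0 < p s → 0 < q (f s) := fun s hs => by
    rw [hq]
    exact (mul_pos hs (hf s)).trans_le
      (Finset.single_le_sum (f := fun s' => p s' * w s' (f s))
        (fun s' _ => mul_nonneg (hp s') (hw s' _)) (Finset.mem_univ s))
  set φ : 𝒴 → ℝ := fun y => if 0 < q y then σ * (1 + T y / q y) ^ (-σ - 1) else 0 with hφ
  set P : 𝒴 → ℝ := fun y => ∑ s, if f s = y then p s else 0 with hP
  have hP0 : ∀ y, 0 ≤ P y := fun y => Finset.sum_nonneg fun s _ => by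
    split_ifs
    exacts [hp s, le_rfl]
  have hPsum : ∀ c : 𝒴 → ℝ, ∑ y, P y * c y = ∑ s, p s * c (f s) := fun c => by
    simp only [hP, Finset.sum_mul]
    rw [Finset.sum_comm]
    simp [ite_mul]
  have hcross : ∀ y, negMulLog (P y) ≤ P y * -log (φ y) + φ y - P y := fun y => by
    rcases (hq0 y).eq_or_lt with h0 | h0
    · have : P y = 0 := Finset.sum_eq_zero fun s _ => by
        split_ifs with h
        · refine ((hp s).eq_or_lt.resolve_right fun hs => ?_).symm
          have := hqpos s hs
          rw [h, ← h0] at this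
          exact lt_irrefl _ this
        · rfl
      simp [this, hφ, ← h0]
    · refine negMulLog_le_cross (hP0 y) ?_
      have := hT y
      simp only [hφ, h0, if_true]
      positivity
  have hterm : ∀ s, p s * -log (φ (f s)) ≤ p s * (-log σ + (1 + σ) *
      (log (1 + w s (f s) / q (f s)) - w s (f s) / q (f s) / (1 + w s (f s) / q (f s))
          + T (f s) / q (f s) / (1 + w s (f s) / q (f s)))) := fun s => by
    rcases (hp s).eq_or_lt with h0 | h0
    · simp [← h0]
    · have h1 := hqpos s h0
      refine mul_le_mul_of_nonneg_left ?_ h0.le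
      simp only [hφ, h1, if_true]
      exact neg_log_lomax_le hσ h1 (div_nonneg (hw _ _) h1.le) (hT _)
  calc ∑ y, negMulLog (P y) ≤ ∑ y, (P y * -log (φ y) + φ y - P y) :=
        Finset.sum_le_sum fun y _ => hcross y
    _ = ∑ s, p s * -log (φ (f s)) + ∑ y, φ y - 1 := by
        rw [Finset.sum_sub_distrib, Finset.sum_add_distrib, hPsum fun y => -log (φ y)]
        have := hPsum fun _ => 1
        simp only [mul_one, hp1] at this
        rw [this]
    _ ≤ _ := by
        have := Finset.sum_le_sum fun s (_ : s ∈ Finset.univ) => hterm s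
        simp only [mul_add, Finset.sum_add_distrib, ← Finset.sum_mul, hp1, one_mul,
          mul_left_comm _ (1 + σ), ← Finset.mul_sum] at this ⊢
        linarith

lemma integrable_and_integral_le {E : Type*} [MeasurableSpace E] {ν : Measure E} {g : E → ℝ}
    (hg : Measurable g) (hg0 : 0 ≤ᵐ[ν] g) {c : ℝ} (hc : 0 ≤ c)
    (h : ∫⁻ e, ENNReal.ofReal (g e) ∂ν ≤ ENNReal.ofReal c) :
    Integrable g ν ∧ ∫ e, g e ∂ν ≤ c := by
  refine ⟨(lintegral_ofReal_ne_top_iff_integrable hg.aestronglyMeasurable hg0).1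
    (h.trans_lt ENNReal.ofReal_lt_top).ne, ?_⟩
  rw [integral_eq_lintegral_of_nonneg_ae hg0 hg.aestronglyMeasurable]
  exact ENNReal.toReal_le_of_le_ofReal hc h

/-- A coupling of the laws `w s` through a race between clocks shared by all `s`. -/
lemma exists_race_selection {𝒮 𝒴 : Type*} [Finite 𝒮] [Fintype 𝒴] [Nonempty 𝒴]
    {w : 𝒮 → 𝒴 → ℝ} (hw : ∀ s y, 0 ≤ w s y) (hw1 : ∀ s, ∑ y, w s y = 1) :
    ∃ (E : Type) (_ : MeasurableSpace E) (ν : Measure E), IsProbabilityMeasure ν ∧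
    ∃ (T : 𝒴 → E → ℝ) (F : E → 𝒮 → 𝒴), (∀ y, Measurable (T y)) ∧ (∀ᵐ e ∂ν, ∀ y, 0 ≤ T y e) ∧
      (∀ s y, MeasurableSet {e | F e s = y}) ∧ (∀ e s, 0 < w s (F e s)) ∧
      (∀ s y, ν.real {e | F e s = y} = w s y) ∧
      (∀ s y, IntegrableOn (T y) {e | F e s = y} ν ∧
        ∫ e in {e | F e s = y}, T y e ∂ν ≤ w s y ^ 2) ∧
      ∀ h : ℝ → ENNReal, Measurable h → ∀ y, ∫⁻ e, h (T y e) ∂ν ≤ ∫⁻ t in Set.Ioi 0, h t := by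
  obtain ⟨E, mE, ν, hν, T, hTm, hT0, hTlaw, hrace⟩ := exists_race 𝒴
  set A : 𝒮 → 𝒴 → Set E := fun s y =>
    {e | 0 < w s y ∧ ∀ j, 0 < w s j → T y e / w s y ≤ T j e / w s j} with hA
  have hAm : ∀ s y, MeasurableSet (A s y) := fun s y => by
    simp only [hA, Set.ofPred_and, Set.ofPred_forall]
    exact (MeasurableSet.const _).inter <| MeasurableSet.iInter fun j =>
      MeasurableSet.iInter fun _ =>
        measurableSet_le ((hTm y).div_const _) ((hTm j).div_const _)
  have hcov : ∀ s e, ∃ y, e ∈ A s y := fun s e => by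
    have hne : (Finset.univ.filter fun y => 0 < w s y).Nonempty := by
      by_contra hcon
      rw [Finset.not_nonempty_iff_eq_empty, Finset.filter_eq_empty_iff] at hcon
      have : ∑ y, w s y = 0 := Finset.sum_eq_zero fun y hy =>
        le_antisymm (not_lt.1 (hcon hy)) (hw s y)
      linarith [hw1 s]
    obtain ⟨y, hy, hmin⟩ := Finset.exists_min_image _ (fun y => T y e / w s y) hne
    exact ⟨y, (Finset.mem_filter.1 hy).2, fun j hj => hmin j (by simpa using hj)⟩
  choose f hfm hfA using fun s => exists_measurable_selection (A s) (hAm s) (hcov s)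
  have hsub : ∀ s y, {e | f s e = y} ⊆
      {e | ∀ j, 0 < w s j → T y e / w s y ≤ T j e / w s j} := fun s y e he => by
    have := (hfA s e).2
    rwa [show f s e = y from he] at this
  have hempty : ∀ s y, w s y = 0 → {e | f s e = y} = ∅ := fun s y h0 => by
    ext e
    simp only [Set.mem_ofPred_eq, Set.mem_empty_iff_false, iff_false]
    rintro rfl
    exact (hfA s e).1.ne' h0
  have hle : ∀ s y, ν.real {e | f s e = y} ≤ w s y := fun s y => by
    rcases (hw s y).eq_or_lt with h0 | h0
    · simp [hempty s y h0.symm, ← h0]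
    · refine ENNReal.toReal_le_of_le_ofReal h0.le ?_
      have := hrace (w s) (hw s) (hw1 s) y h0 (fun _ => 1) measurable_const
      simp only [lintegral_one, Measure.restrict_apply_univ, one_mul,
        lintegral_exp_neg_div h0] at this
      exact (measure_mono (hsub s y)).trans this
  have hsum : ∀ s, ∑ y, ν.real {e | f s e = y} = 1 := fun s => by
    have := (integral_comp_eq_sum ν (hfm s) fun _ => 1).2
    simpa using this.symm
  refine ⟨E, mE, ν, hν, T, fun e s => f s e, hTm, hT0, hfm, fun e s => (hfA s e).1,
    fun s y => ?_, fun s y => ?_, hTlaw⟩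
  · exact (Finset.sum_eq_sum_iff_of_le fun y _ => hle s y).1 ((hsum s).trans (hw1 s).symm) y
      (Finset.mem_univ y)
  · rcases (hw s y).eq_or_lt with h0 | h0
    · simp [hempty s y h0.symm, ← h0]
    · refine integrable_and_integral_le (hTm y) ?_ (by positivity) ?_
      · exact ae_restrict_of_ae (hT0.mono fun e he => he y)
      · have := hrace (w s) (hw s) (hw1 s) y h0 ENNReal.ofReal ENNReal.measurable_ofReal
        rw [lintegral_mul_exp_neg_div h0] at this
        exact (lintegral_mono_set (hsub s y)).trans this

lemma race_term_le {p w q : ℝ} (hp : 0 ≤ p) (hw : 0 ≤ w) (hq : 0 ≤ q) (hpq : p * w ≤ q) :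
    p * ((log (1 + w / q) - w / q / (1 + w / q)) * w + w ^ 2 / q / (1 + w / q)) ≤
      p * (w * log (w / q)) + p * w * log 2 + (p * q - p * w) / 2 := by
  rcases hp.eq_or_lt with rfl | hp
  · simp
  rcases hw.eq_or_lt with rfl | hw
  · have := mul_nonneg hp.le hq
    simpa using div_nonneg this zero_le_two
  have hq : 0 < q := (mul_pos hp hw).trans_le hpq
  have h := mul_le_mul_of_nonneg_left (log_one_add_le_log_add (div_pos hw hq)) (mul_pos hp hw).le
  have e1 : w ^ 2 / q / (1 + w / q) = w / q / (1 + w / q) * w := by ring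
  have e2 : p * w * (((w / q)⁻¹ - 1) / 2) = (p * q - p * w) / 2 := by field_simp
  rw [mul_add, mul_add, e2] at h
  rw [e1]
  linarith

/-- Strong functional representation: the laws `w s` are the marginals of a random function `f`
for which the mean entropy (in nats) of `f S`, with `S` of law `p`, is close to the mutual
information of the channel `w`. -/
lemma exists_random_function {𝒮 𝒴 : Type*} [Fintype 𝒮] [DecidableEq 𝒮] [Fintype 𝒴] [DecidableEq 𝒴]
    [Nonempty 𝒴]
    {p : 𝒮 → ℝ} {w : 𝒮 → 𝒴 → ℝ} (hp : ∀ s, 0 ≤ p s) (hp1 : ∑ s, p s = 1)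
    (hw : ∀ s y, 0 ≤ w s y) (hw1 : ∀ s, ∑ y, w s y = 1)
    {q : 𝒴 → ℝ} (hq : ∀ y, q y = ∑ s, p s * w s y) {σ : ℝ} (hσ : 0 < σ) :
    ∃ Q : (𝒮 → 𝒴) → ℝ, (∀ f, 0 ≤ Q f) ∧ ∑ f, Q f = 1 ∧
      (∀ s y, ∑ f, (if f s = y then Q f else 0) = w s y) ∧
      ∑ f, Q f * ∑ y, negMulLog (∑ s, if f s = y then p s else 0) ≤
        -log σ + (1 + σ) * (∑ s, p s * ∑ y, w s y * log (w s y / q y) + log 2) := by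
  obtain ⟨E, mE, ν, hν, T, F, hTm, hT0, hFm, hFpos, hFlaw, hTint, hTlaw⟩ :=
    exists_race_selection hw hw1
  have hq0 : ∀ y, 0 ≤ q y := fun y => by
    rw [hq]
    exact Finset.sum_nonneg fun s _ => mul_nonneg (hp s) (hw s y)
  have hFm' : ∀ f, MeasurableSet {e | F e = f} := fun f => by
    simp only [funext_iff, Set.ofPred_forall]
    exact MeasurableSet.iInter fun s => hFm s (f s)
  have hint := integral_comp_eq_sum ν hFm'
  refine ⟨fun f => ν.real {e | F e = f}, fun f => measureReal_nonneg, ?_, fun s y => ?_, ?_⟩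
  · have := (hint fun _ => 1).2
    simpa using this.symm
  · have := (hint fun f => if f s = y then 1 else 0).2
    simp only [mul_ite, mul_one, mul_zero] at this
    rw [← this, ← hFlaw s y, ← integral_indicator_one (hFm s y)]
    simp [Set.indicator_apply]
  · set a : 𝒮 → 𝒴 → ℝ := fun s y =>
      log (1 + w s y / q y) - w s y / q y / (1 + w s y / q y) with ha
    set φ : 𝒴 → E → ℝ := fun y e =>
      if 0 < q y then σ * (1 + T y e / q y) ^ (-σ - 1) else 0 with hφ
    have hφint : ∀ y, Integrable (φ y) ν ∧ ∫ e, φ y e ∂ν ≤ q y := fun y => by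
      rcases (hq0 y).eq_or_lt with h0 | h0
      · simp [hφ, ← h0]
      · simp only [hφ, h0, if_true]
        refine integrable_and_integral_le ?_ ?_ h0.le ?_
        · have := hTm y
          fun_prop
        · filter_upwards [hT0] with e he
          have := he y
          simp only [Pi.zero_apply]
          positivity
        · refine (hTlaw (fun t => ENNReal.ofReal (σ * (1 + t / q y) ^ (-σ - 1)))
            (by fun_prop) y).trans ?_
          rw [lintegral_lomax hσ h0]
    have hterm : ∀ s y, Integrable ({e | F e s = y}.indicator fun e =>
          a s y + T y e / q y / (1 + w s y / q y)) ν ∧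
        ∫ e, {e | F e s = y}.indicator (fun e => a s y + T y e / q y / (1 + w s y / q y)) e ∂ν
          ≤ a s y * w s y + w s y ^ 2 / q y / (1 + w s y / q y) := fun s y => by
      have h1 : IntegrableOn (fun _ => a s y) {e | F e s = y} ν := (integrable_const _).integrableOn
      have h2 := ((hTint s y).1.div_const (q y)).div_const (1 + w s y / q y)
      refine ⟨(integrable_indicator_iff (hFm s y)).2 (h1.add h2), ?_⟩
      rw [integral_indicator (hFm s y), integral_add h1 h2, integral_div, integral_div,
        setIntegral_const, hFlaw, smul_eq_mul, mul_comm]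
      have := div_nonneg (hw s y) (hq0 y)
      have := hq0 y
      gcongr
      exact (hTint s y).2
    have hpoint : ∀ᵐ e ∂ν, ∑ y, negMulLog (∑ s, if F e s = y then p s else 0) ≤
        -log σ + (1 + σ) * ∑ s, p s * ∑ y, {e | F e s = y}.indicator
            (fun e => a s y + T y e / q y / (1 + w s y / q y)) e + ∑ y, φ y e - 1 := by
      filter_upwards [hT0] with e he
      have := entropy_fiber_le hp hp1 hw hσ hq (hFpos e) he
      simpa [Set.indicator_apply] using this
    have hI1 : Integrable (fun e => ∑ s, p s * ∑ y, {e | F e s = y}.indicator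
        (fun e => a s y + T y e / q y / (1 + w s y / q y)) e) ν :=
      integrable_finsetSum _ fun s _ =>
        (integrable_finsetSum _ fun y _ => (hterm s y).1).const_mul _
    have hI2 : Integrable (fun e => ∑ y, φ y e) ν := integrable_finsetSum _ fun y _ => (hφint y).1
    have hqsum : ∑ y, q y = 1 := by
      simp only [hq]
      rw [Finset.sum_comm]
      simp only [← Finset.mul_sum, hw1, mul_one, hp1]
    have hpw : ∀ s y, p s * w s y ≤ q y := fun s y => by
      rw [hq]
      exact Finset.single_le_sum (f := fun s => p s * w s y)
        (fun s _ => mul_nonneg (hp s) (hw s y)) (Finset.mem_univ s)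
    have hB1 : ∫ e, ∑ s, p s * ∑ y, {e | F e s = y}.indicator
        (fun e => a s y + T y e / q y / (1 + w s y / q y)) e ∂ν ≤
          ∑ s, p s * ∑ y, w s y * log (w s y / q y) + log 2 := by
      rw [integral_finsetSum _ fun s _ =>
        (integrable_finsetSum _ fun y _ => (hterm s y).1).const_mul _]
      calc _ ≤ ∑ s, p s * ∑ y, (a s y * w s y + w s y ^ 2 / q y / (1 + w s y / q y)) := by
            refine Finset.sum_le_sum fun s _ => ?_
            rw [integral_const_mul, integral_finsetSum _ fun y _ => (hterm s y).1]
            exact mul_le_mul_of_nonneg_left (Finset.sum_le_sum fun y _ => (hterm s y).2) (hp s)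
        _ ≤ ∑ s, ∑ y, (p s * (w s y * log (w s y / q y)) + p s * w s y * log 2
              + (p s * q y - p s * w s y) / 2) := by
            simp only [Finset.mul_sum]
            exact Finset.sum_le_sum fun s _ => Finset.sum_le_sum fun y _ =>
              race_term_le (hp s) (hw s y) (hq0 y) (hpw s y)
        _ = _ := by
            simp only [Finset.sum_add_distrib, ← Finset.sum_div, Finset.sum_sub_distrib,
              ← Finset.mul_sum, ← Finset.sum_mul, hw1, hqsum, mul_one, hp1]
            ring
    have hB2 : ∫ e, ∑ y, φ y e ∂ν ≤ 1 := by
      rw [integral_finsetSum _ fun y _ => (hφint y).1, ← hqsum]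
      exact Finset.sum_le_sum fun y _ => (hφint y).2
    have hG := hint fun f => ∑ y, negMulLog (∑ s, if f s = y then p s else 0)
    rw [← hG.2]
    have hI3 := (integrable_const (μ := ν) (-log σ)).add (hI1.const_mul (1 + σ))
    refine (integral_mono_ae hG.1 ((hI3.add hI2).sub (integrable_const 1)) hpoint).trans ?_
    rw [integral_sub' (hI3.add hI2) (integrable_const 1), integral_add' hI3 hI2,
      integral_add' (integrable_const _) (hI1.const_mul _), integral_const_mul]
    simp only [integral_const, probReal_univ, one_smul]
    have := mul_le_mul_of_nonneg_left hB1 (by linarith : (0 : ℝ) ≤ 1 + σ)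
    linarith

/-- The entropy, in nats, of the image of the weights `p` under `g`. -/
def fiberEnt {α β : Type*} [Fintype α] [Fintype β] [DecidableEq β] (p : α → ℝ) (g : α → β) : ℝ :=
  ∑ x, negMulLog (∑ a, if g a = x then p a else 0)

section fiberEnt

variable {α β γ : Type*} [Fintype α] [Fintype β] [DecidableEq β] [Fintype γ] [DecidableEq γ]

lemma fiberEnt_comp_injective (p : α → ℝ) (g : α → β) {h : β → γ} (hh : h.Injective) :
    fiberEnt p (fun a => h (g a)) = fiberEnt p g := by
  unfold fiberEnt
  symm
  refine Fintype.sum_of_injective h hh _ _ (fun y hy => ?_) fun x => ?_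
  · have : ∀ a, h (g a) ≠ y := fun a ha => hy ⟨_, ha⟩
    simp [this]
  · simp [hh.eq_iff]

lemma fiberEnt_injective (p : α → ℝ) {g : α → β} (hg : g.Injective) :
    fiberEnt p g = ∑ a, negMulLog (p a) := by
  classical
  exact (fiberEnt_comp_injective p id hg).trans (by simp [fiberEnt])

lemma negMulLog_sum_le {p : α → ℝ} (hp : ∀ a, 0 ≤ p a) :
    negMulLog (∑ a, p a) ≤ ∑ a, negMulLog (p a) := by
  simp only [negMulLog, neg_mul, Finset.sum_neg_distrib, neg_le_neg_iff, Finset.sum_mul]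
  refine Finset.sum_le_sum fun a _ => ?_
  rcases (hp a).eq_or_lt with h0 | h0
  · simp [← h0]
  · exact mul_le_mul_of_nonneg_left
      (Real.log_le_log h0 (Finset.single_le_sum (fun a _ => hp a) (Finset.mem_univ a))) h0.le

lemma fiberEnt_le {p : α → ℝ} (hp : ∀ a, 0 ≤ p a) (g : α → β) :
    fiberEnt p g ≤ ∑ a, negMulLog (p a) := by
  calc fiberEnt p g ≤ ∑ x, ∑ a, negMulLog (if g a = x then p a else 0) :=
        Finset.sum_le_sum fun x _ => negMulLog_sum_le fun a => by
          split_ifs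
          exacts [hp a, le_rfl]
    _ = _ := by
        rw [Finset.sum_comm]
        simp [apply_ite negMulLog]

lemma sum_fiber (p : α → ℝ) (g : α → β) :
    ∑ x, ∑ a, (if g a = x then p a else 0) = ∑ a, p a := by
  rw [Finset.sum_comm]
  simp

/-- Chain rule for a pair whose first component is independent of the source of the second. -/
lemma fiberEnt_prod {α β γ : Type*} [Fintype α] [DecidableEq α] [Fintype β] [Fintype γ]
    [DecidableEq γ] {Q : α → ℝ} {b : β → ℝ} (hb : ∑ x, b x = 1)
    (h : α → β → γ) :
    fiberEnt (fun z : α × β => Q z.1 * b z.2) (fun z => (z.1, h z.1 z.2)) =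
      ∑ f, negMulLog (Q f) + ∑ f, Q f * fiberEnt b (h f) := by
  have hlaw : ∀ f v, (∑ z : α × β, if (z.1, h z.1 z.2) = (f, v) then Q z.1 * b z.2 else 0) =
      Q f * ∑ x, if h f x = v then b x else 0 := fun f v => by
    rw [Fintype.sum_prod_type, Finset.sum_eq_single f]
    · simp [Finset.mul_sum]
    · intro f' _ hf'
      simp [hf']
    · simp
  have hone : ∀ f, ∑ v, (∑ x, if h f x = v then b x else 0) = 1 := fun f =>
    (sum_fiber b (h f)).trans hb
  simp only [fiberEnt]
  rw [Fintype.sum_prod_type]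
  simp only [hlaw, negMulLog_mul, Finset.sum_add_distrib, ← Finset.sum_mul, ← Finset.mul_sum, hone,
    one_mul]

/-- Entropy of an erased observation `k` of the source together with a further observation `g`. -/
lemma fiberEnt_erasure {p : α → ℝ} (hp : ∑ a, p a = 1) (c : ℝ) (k : α → β) (g : α → γ) :
    fiberEnt (fun z : α × Bool => p z.1 * if z.2 then c else 1 - c)
        (fun z => (if z.2 then some (k z.1) else none, g z.1)) =
      negMulLog c + negMulLog (1 - c) + (1 - c) * fiberEnt p g
        + c * fiberEnt p (fun a => (k a, g a)) := by
  have h1 : ∀ v, (∑ z : α × Bool, if (if z.2 then some (k z.1) else none, g z.1) = (none, v)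
      then p z.1 * (if z.2 then c else 1 - c) else 0) =
      (1 - c) * ∑ a, if g a = v then p a else 0 := fun v => by
    simp [Fintype.sum_prod_type, Finset.mul_sum, mul_comm]
  have h2 : ∀ t v, (∑ z : α × Bool, if (if z.2 then some (k z.1) else none, g z.1) = (some t, v)
      then p z.1 * (if z.2 then c else 1 - c) else 0) =
      c * ∑ a, if (k a, g a) = (t, v) then p a else 0 := fun t v => by
    simp [Fintype.sum_prod_type, Finset.mul_sum, mul_comm]
  have hg := (sum_fiber p g).trans hp
  have hkg := (sum_fiber p fun a => (k a, g a)).trans hp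
  simp only [fiberEnt]
  rw [Fintype.sum_prod_type, Fintype.sum_option]
  simp only [h1, h2, negMulLog_mul]
  rw [← Fintype.sum_prod_type' (f := fun t v => (∑ a, if (k a, g a) = (t, v) then p a else 0) *
    negMulLog c + c * negMulLog (∑ a, if (k a, g a) = (t, v) then p a else 0))]
  simp only [Finset.sum_add_distrib, ← Finset.sum_mul, ← Finset.mul_sum, hg, hkg]
  ring

end fiberEnt

lemma pm_nonneg {Ω 𝒳 : Type*} [MeasurableSpace Ω] (μ : Measure Ω) (X : Ω → 𝒳) (x : 𝒳) :
    0 ≤ pm μ X x :=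
  ENNReal.toReal_nonneg

section marginals

variable {Ω A B : Type*} [MeasurableSpace Ω] {μ : Measure Ω} [IsProbabilityMeasure μ]
  [Fintype A] {X : Ω → A}

lemma pm_comp [DecidableEq B] (hX : ∀ a, MeasurableSet (X ⁻¹' {a})) (g : A → B) (x : B) :
    pm μ (fun ω => g (X ω)) x = ∑ a, if g a = x then pm μ X a else 0 := by
  have := integral_comp_eq_sum μ hX fun a => if g a = x then 1 else 0
  have hm : MeasurableSet ((fun ω => g (X ω)) ⁻¹' {x}) := by
    have : (fun ω => g (X ω)) ⁻¹' {x} = ⋃ a ∈ {a | g a = x}, X ⁻¹' {a} := by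
      ext ω
      simp
    rw [this]
    exact MeasurableSet.biUnion (Set.to_countable _) fun a _ => hX a
  have h2 : ∫ ω, (if g (X ω) = x then (1 : ℝ) else 0) ∂μ = pm μ (fun ω => g (X ω)) x := by
    rw [pm, ← measureReal_def, ← integral_indicator_one hm]
    refine integral_congr_ae (ae_of_all _ fun ω => ?_)
    by_cases h : g (X ω) = x <;> simp [h]
  rw [← h2, this.2]
  simp only [mul_ite, mul_one, mul_zero]
  rfl

lemma sum_pm (hX : ∀ a, MeasurableSet (X ⁻¹' {a})) : ∑ a, pm μ X a = 1 := by
  have := (integral_comp_eq_sum μ hX fun _ => 1).2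
  simp only [integral_const, probReal_univ, smul_eq_mul, mul_one] at this
  exact this.symm

lemma ent_eq {Ω A : Type*} [MeasurableSpace Ω] (μ : Measure Ω) [Fintype A] (X : Ω → A) :
    ent μ X = (∑ a, negMulLog (pm μ X a)) / log 2 := by
  simp only [ent, negMulLog, logb, Finset.sum_div, ← Finset.sum_neg_distrib]
  exact Finset.sum_congr rfl fun a _ => by ring

lemma ent_comp [Fintype B] [DecidableEq B] (hX : ∀ a, MeasurableSet (X ⁻¹' {a})) (g : A → B) :
    ent μ (fun ω => g (X ω)) = fiberEnt (pm μ X) g / log 2 := by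
  simp only [ent_eq, pm_comp hX, fiberEnt]

end marginals

lemma exists_pm_eq {A : Type*} [Fintype A] {p : A → ℝ} (hp : ∀ a, 0 ≤ p a) (hp1 : ∑ a, p a = 1) :
    ∃ (Ω : Type) (_ : MeasurableSpace Ω) (μ : Measure Ω) (Z : Ω → A), IsProbabilityMeasure μ ∧
      (∀ s : Set Ω, MeasurableSet s) ∧ pm μ Z = p := by
  classical
  have κ := Fintype.equivFin A
  refine ⟨Fin (Fintype.card A), inferInstance,
    (PMF.ofFintype (fun i => ENNReal.ofReal (p (κ.symm i))) ?_).toMeasure, κ.symm, inferInstance,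
    fun _ => MeasurableSet.of_discrete, ?_⟩
  · rw [← ENNReal.ofReal_sum_of_nonneg fun i _ => hp _, Equiv.sum_comp κ.symm p, hp1,
      ENNReal.ofReal_one]
  · ext a
    have : κ.symm ⁻¹' {a} = {κ a} := by
      ext i
      simp [Equiv.symm_apply_eq]
    rw [pm, this, PMF.toMeasure_apply_singleton _ _ (measurableSet_singleton _)]
    simp [hp a]

lemma map_eq_of_pm_eq {Ω Ω' A : Type*} [MeasurableSpace Ω] [MeasurableSpace Ω'] {μ : Measure Ω}
    {ν : Measure Ω'} [IsFiniteMeasure μ] [IsFiniteMeasure ν] [Countable A] [MeasurableSpace A]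
    [MeasurableSingletonClass A] {X : Ω → A} {Z : Ω' → A} (hX : Measurable X) (hZ : Measurable Z)
    (h : ∀ a, pm μ X a = pm ν Z a) : μ.map X = ν.map Z := by
  refine Measure.ext_of_singleton fun a => ?_
  rw [Measure.map_apply hX (measurableSet_singleton a),
    Measure.map_apply hZ (measurableSet_singleton a)]
  exact (ENNReal.toReal_eq_toReal_iff' (measure_ne_top _ _) (measure_ne_top _ _)).1 (h a)

/-- Mutual information, in nats, of the channel `w` with input law `p` and output law `q`. -/
lemma sum_mul_log_div_eq {𝒮 𝒴 : Type*} [Fintype 𝒮] [Fintype 𝒴] {p : 𝒮 → ℝ} {w : 𝒮 → 𝒴 → ℝ}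
    (hp : ∀ s, 0 ≤ p s) (hw : ∀ s y, 0 ≤ w s y) (hw1 : ∀ s, ∑ y, w s y = 1)
    {q : 𝒴 → ℝ} (hq : ∀ y, q y = ∑ s, p s * w s y) :
    ∑ s, p s * ∑ y, w s y * log (w s y / q y) =
      ∑ s, negMulLog (p s) + ∑ y, negMulLog (q y) - ∑ s, ∑ y, negMulLog (p s * w s y) := by
  have hterm : ∀ s y, p s * (w s y * log (w s y / q y)) =
      w s y * negMulLog (p s) - p s * w s y * log (q y) - negMulLog (p s * w s y) := fun s y => by
    rw [negMulLog_mul]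
    rcases (hp s).eq_or_lt with h0 | h0
    · simp [← h0]
    rcases (hw s y).eq_or_lt with h1 | h1
    · simp [← h1]
    have : 0 < q y := by
      rw [hq]
      exact (mul_pos h0 h1).trans_le (Finset.single_le_sum (f := fun s => p s * w s y)
        (fun s _ => mul_nonneg (hp s) (hw s y)) (Finset.mem_univ s))
    rw [Real.log_div h1.ne' this.ne', negMulLog, negMulLog]
    ring
  have hqlog : ∑ s, ∑ y, p s * w s y * log (q y) = -∑ y, negMulLog (q y) := by
    rw [Finset.sum_comm, ← Finset.sum_neg_distrib]
    refine Finset.sum_congr rfl fun y _ => ?_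
    rw [← Finset.sum_mul, ← hq, negMulLog]
    ring
  simp only [Finset.mul_sum, hterm, Finset.sum_sub_distrib, hqlog, ← Finset.sum_mul, hw1, one_mul]
  ring

/-- Every joint law is an input law followed by a channel. -/
lemma exists_channel {𝒮 𝒴 : Type*} [Fintype 𝒴] [Nonempty 𝒴] {r : 𝒮 × 𝒴 → ℝ} (hr : ∀ a, 0 ≤ r a)
    {p : 𝒮 → ℝ} (hp : ∀ s, p s = ∑ y, r (s, y)) :
    ∃ w : 𝒮 → 𝒴 → ℝ, (∀ s y, 0 ≤ w s y) ∧ (∀ s, ∑ y, w s y = 1) ∧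
      ∀ s y, r (s, y) = p s * w s y := by
  classical
  obtain ⟨y₀⟩ := ‹Nonempty 𝒴›
  have hp0 : ∀ s, 0 ≤ p s := fun s => by
    rw [hp]
    exact Finset.sum_nonneg fun y _ => hr _
  refine ⟨fun s y => if p s = 0 then (if y = y₀ then 1 else 0) else r (s, y) / p s,
    fun s y => ?_, fun s => ?_, fun s y => ?_⟩
  · have := hp0 s
    have := hr (s, y)
    positivity
  · by_cases h : p s = 0
    · simp [h]
    · simp only [h, if_false, ← Finset.sum_div, ← hp]
      exact div_self h
  · by_cases h : p s = 0
    · have h' := h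
      rw [hp, Finset.sum_eq_zero_iff_of_nonneg fun y _ => hr _] at h'
      simp [h, h' y (Finset.mem_univ y)]
    · simp only [h, if_false]
      field_simp

/-- Entropy of a random function `f`, an erased observation `k` of an independent source, and a
further observation `g` of both. -/
lemma ent_erasure {Ω F 𝒮 𝒯 β 𝒰 : Type*} [MeasurableSpace Ω] {μ : Measure Ω} [IsProbabilityMeasure μ]
    [Fintype F] [Fintype 𝒮] [Fintype 𝒯] [DecidableEq 𝒯] [Fintype β] [DecidableEq β] [Fintype 𝒰]
    {Q : F → ℝ} {p : 𝒮 → ℝ} (hQ1 : ∑ f, Q f = 1) (hp1 : ∑ s, p s = 1) {c : ℝ}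
    {Z : Ω → F × (𝒮 × Bool)} (hZs : ∀ a, MeasurableSet (Z ⁻¹' {a}))
    (hZ : pm μ Z = fun z => Q z.1 * (p z.2.1 * if z.2.2 then c else 1 - c))
    {κ : F × Option 𝒯 → 𝒰} (hκ : κ.Injective) (k : 𝒮 → 𝒯) (g : F → 𝒮 → β) :
    ent μ (fun ω => (κ ((Z ω).1, if (Z ω).2.2 then some (k (Z ω).2.1) else none),
        g (Z ω).1 (Z ω).2.1)) =
      (∑ f, negMulLog (Q f) + (negMulLog c + negMulLog (1 - c))
        + (1 - c) * ∑ f, Q f * fiberEnt p (g f)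
        + c * ∑ f, Q f * fiberEnt p (fun s => (k s, g f s))) / log 2 := by
  classical
  have hb1 : ∑ x : 𝒮 × Bool, p x.1 * (if x.2 then c else 1 - c) = 1 := by
    simp [Fintype.sum_prod_type, ← mul_add, hp1]
  have hinj : Function.Injective fun v : F × (Option 𝒯 × β) => (κ (v.1, v.2.1), v.2.2) := by
    rintro ⟨f, o, b⟩ ⟨f', o', b'⟩ h
    simp only [Prod.mk.injEq] at h
    have := hκ h.1
    simp_all
  rw [ent_comp hZs fun z => (κ (z.1, if z.2.2 then some (k z.2.1) else none), g z.1 z.2.1), hZ,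
    fiberEnt_comp_injective _ (fun z : F × (𝒮 × Bool) =>
      (z.1, (if z.2.2 then some (k z.2.1) else none), g z.1 z.2.1)) hinj,
    fiberEnt_prod hb1 fun f x => ((if x.2 then some (k x.1) else none), g f x.1)]
  simp only [fiberEnt_erasure hp1, mul_add, Finset.sum_add_distrib, ← Finset.sum_mul, hQ1, one_mul,
    mul_left_comm (Q _), ← Finset.mul_sum]
  ring

/-- lower bound `L_h^4(ε)` of Theorem 1 for a fixed representation
`S = (S1,S2)`. With `0 ≤ ε < I(S;Y)`, `ε ≤ H(S2)`, `H(S2) > 0` and `α2 = ε/H(S2)`, there is a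
probability space carrying `(S1',S2',Y')` distributed as `(S1,S2,Y)` and a finite-valued `U`
with `I(U;(S1',S2')) ≤ ε` and
`I(U;Y') ≥ H(Y|S) + ε − α2·H(S|Y) − (1−α2)·(log₂(I(S;Y)+1) + 4)`. -/
theorem exists_lower_bound_L4
    {Ω : Type*} [MeasurableSpace Ω] (μ : Measure Ω) [IsProbabilityMeasure μ]
    {𝒮₁ 𝒮₂ 𝒴 : Type*}
    [Fintype 𝒮₁] [Nonempty 𝒮₁] [MeasurableSpace 𝒮₁] [MeasurableSingletonClass 𝒮₁]
    [Fintype 𝒮₂] [Nonempty 𝒮₂] [MeasurableSpace 𝒮₂] [MeasurableSingletonClass 𝒮₂]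
    [Fintype 𝒴] [Nonempty 𝒴] [MeasurableSpace 𝒴] [MeasurableSingletonClass 𝒴]
    (S₁ : Ω → 𝒮₁) (S₂ : Ω → 𝒮₂) (Y : Ω → 𝒴)
    (hS₁ : Measurable S₁) (hS₂ : Measurable S₂) (hY : Measurable Y)
    (ε : ℝ) (hε0 : 0 ≤ ε) (hε : ε < mi μ (fun ω => (S₁ ω, S₂ ω)) Y)
    (hH2 : 0 < ent μ S₂) (hε2 : ε ≤ ent μ S₂)
    (α₂ : ℝ) (hα₂ : α₂ = ε / ent μ S₂) :
    ∃ (Ω' : Type) (mΩ' : MeasurableSpace Ω'), haveI := mΩ';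
    ∃ (μ' : Measure Ω'), IsProbabilityMeasure μ' ∧
    ∃ (S₁' : Ω' → 𝒮₁) (S₂' : Ω' → 𝒮₂) (Y' : Ω' → 𝒴),
      Measurable S₁' ∧ Measurable S₂' ∧ Measurable Y' ∧
      Measure.map (fun ω => (S₁' ω, S₂' ω, Y' ω)) μ'
        = Measure.map (fun ω => (S₁ ω, S₂ ω, Y ω)) μ ∧
      ∃ (𝒰 : Type) (iF : Fintype 𝒰) (iN : Nonempty 𝒰) (iM : MeasurableSpace 𝒰),
        haveI := iF; haveI := iM;
      ∃ (iMS : MeasurableSingletonClass 𝒰) (U : Ω' → 𝒰), Measurable U ∧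
        mi μ' U (fun ω => (S₁' ω, S₂' ω)) ≤ ε ∧
        condEnt μ Y (fun ω => (S₁ ω, S₂ ω)) + ε
            - α₂ * condEnt μ (fun ω => (S₁ ω, S₂ ω)) Y
            - (1 - α₂) * (Real.logb 2 (mi μ (fun ω => (S₁ ω, S₂ ω)) Y + 1) + 4)
          ≤ mi μ' U Y' := by
  classical
  set S : Ω → 𝒮₁ × 𝒮₂ := fun ω => (S₁ ω, S₂ ω) with hS
  have hSm : Measurable S := hS₁.prodMk hS₂
  have hX : ∀ a, MeasurableSet ((fun ω => (S ω, Y ω)) ⁻¹' {a}) := fun a =>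
    (hSm.prodMk hY) (measurableSet_singleton a)
  have hSs : ∀ s, MeasurableSet (S ⁻¹' {s}) := fun s => hSm (measurableSet_singleton s)
  set p := pm μ S with hp
  set q := pm μ Y with hq
  have hp0 : ∀ s, 0 ≤ p s := pm_nonneg μ S
  have hp1 : ∑ s, p s = 1 := sum_pm hSs
  have hpr : ∀ s, p s = ∑ y, pm μ (fun ω => (S ω, Y ω)) (s, y) := fun s => by
    rw [hp, pm_comp hX Prod.fst s, Fintype.sum_prod_type, Finset.sum_comm]
    simp
  have hqr : ∀ y, q y = ∑ s, pm μ (fun ω => (S ω, Y ω)) (s, y) := fun y => by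
    rw [hq, pm_comp hX Prod.snd y, Fintype.sum_prod_type]
    simp
  obtain ⟨w, hw0, hw1, hrw⟩ := exists_channel (pm_nonneg μ _) hpr
  simp only [hrw] at hqr
  have hlog2 : 0 < log 2 := Real.log_pos one_lt_two
  set I := mi μ S Y with hI
  have hInat : ∑ s, p s * ∑ y, w s y * log (w s y / q y) = I * log 2 := by
    rw [sum_mul_log_div_eq hp0 hw0 hw1 hqr, hI, mi, ent_eq, ent_eq, ent_eq,
      Fintype.sum_prod_type (f := fun a => negMulLog (pm μ (fun ω => (S ω, Y ω)) a))]
    simp only [hrw, ← hp, ← hq]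
    field_simp
  have hIpos : 0 < I + 1 := by linarith
  obtain ⟨Q, hQ0, hQ1, hQw, hQG⟩ :=
    exists_random_function hp0 hp1 hw0 hw1 hqr (inv_pos.2 hIpos)
  have hα0 : 0 ≤ α₂ := hα₂ ▸ div_nonneg hε0 hH2.le
  have hα1 : α₂ ≤ 1 := hα₂ ▸ div_le_one_of_le₀ hε2 hH2.le
  have hb1 : ∑ x : (𝒮₁ × 𝒮₂) × Bool, p x.1 * (if x.2 then α₂ else 1 - α₂) = 1 := by
    simp [Fintype.sum_prod_type, ← mul_add, hp1]
  obtain ⟨Ω', mΩ', μ', Z, hμ', hall, hZ⟩ := exists_pm_eq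
    (p := fun z : ((𝒮₁ × 𝒮₂ → 𝒴) × ((𝒮₁ × 𝒮₂) × Bool)) =>
      Q z.1 * (p z.2.1 * if z.2.2 then α₂ else 1 - α₂))
    (fun z => mul_nonneg (hQ0 _) (mul_nonneg (hp0 _) (by split_ifs <;> linarith)))
    (by rw [Fintype.sum_prod_type]; simp only [← Finset.mul_sum, hb1, mul_one, hQ1])
  have hZs : ∀ a, MeasurableSet (Z ⁻¹' {a}) := fun _ => hall _
  have hpm : pm μ' (fun ω => ((Z ω).2.1.1, (Z ω).2.1.2, (Z ω).1 (Z ω).2.1)) =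
      pm μ (fun ω => (S₁ ω, S₂ ω, Y ω)) := by
    ext a
    obtain ⟨s₁, s₂, y⟩ := a
    have h1 : pm μ (fun ω => (S₁ ω, S₂ ω, Y ω)) (s₁, s₂, y) = p (s₁, s₂) * w (s₁, s₂) y := by
      rw [← hrw, pm, pm]
      congr 2
      ext ω
      simp [hS, and_assoc]
    rw [h1, pm_comp hZs (fun z => (z.2.1.1, z.2.1.2, z.1 z.2.1)), hZ, Fintype.sum_prod_type,
      ← hQw, Finset.mul_sum]
    refine Finset.sum_congr rfl fun f _ => ?_
    rw [Fintype.sum_prod_type, Finset.sum_eq_single (s₁, s₂)]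
    · by_cases h : f (s₁, s₂) = y
      · simp [h]
        ring
      · simp [h]
    · intro s _ hs
      have : ¬ (s.1 = s₁ ∧ s.2 = s₂) := fun h => hs (Prod.ext h.1 h.2)
      have : ∀ c, ¬ (s.1, s.2, c) = (s₁, s₂, y) := by
        intro c hc
        simp only [Prod.mk.injEq] at hc
        exact this ⟨hc.1, hc.2.1⟩
      simp [this]
    · simp
  have hlaw : Measure.map (fun ω => ((Z ω).2.1.1, (Z ω).2.1.2, (Z ω).1 (Z ω).2.1)) μ' =
      Measure.map (fun ω => (S₁ ω, S₂ ω, Y ω)) μ :=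
    map_eq_of_pm_eq (fun _ _ => hall _) (hS₁.prodMk (hS₂.prodMk hY)) (congrFun hpm)
  set κ := Fintype.equivFin ((𝒮₁ × 𝒮₂ → 𝒴) × Option 𝒮₂)
  set U : Ω' → Fin (Fintype.card ((𝒮₁ × 𝒮₂ → 𝒴) × Option 𝒮₂)) := fun ω =>
    κ ((Z ω).1, if (Z ω).2.2 then some (Z ω).2.1.2 else none)
  refine ⟨Ω', mΩ', μ', hμ', fun ω => (Z ω).2.1.1, fun ω => (Z ω).2.1.2, fun ω => (Z ω).1 (Z ω).2.1,
    fun _ _ => hall _, fun _ _ => hall _, fun _ _ => hall _, hlaw, _, inferInstance,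
    ⟨κ (Classical.arbitrary _)⟩, inferInstance, inferInstance, U, fun _ _ => hall _, ?_⟩
  have hWs : ∀ a, MeasurableSet ((fun ω => (S₁ ω, S₂ ω, Y ω)) ⁻¹' {a}) := fun a =>
    (hS₁.prodMk (hS₂.prodMk hY)) (measurableSet_singleton a)
  have hentS : ent μ' (fun ω => ((Z ω).2.1.1, (Z ω).2.1.2)) = ent μ S := by
    have h1 := ent_comp (μ := μ')
      (X := fun ω => ((Z ω).2.1.1, (Z ω).2.1.2, (Z ω).1 (Z ω).2.1)) (fun _ => hall _)
      fun a : 𝒮₁ × 𝒮₂ × 𝒴 => (a.1, a.2.1)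
    rw [hpm] at h1
    exact h1.trans (ent_comp hWs fun a : 𝒮₁ × 𝒮₂ × 𝒴 => (a.1, a.2.1)).symm
  have hentY : ent μ' (fun ω => (Z ω).1 (Z ω).2.1) = ent μ Y := by
    have h1 := ent_comp (μ := μ')
      (X := fun ω => ((Z ω).2.1.1, (Z ω).2.1.2, (Z ω).1 (Z ω).2.1)) (fun _ => hall _)
      fun a : 𝒮₁ × 𝒮₂ × 𝒴 => a.2.2
    rw [hpm] at h1
    exact h1.trans (ent_comp hWs fun a : 𝒮₁ × 𝒮₂ × 𝒴 => a.2.2).symm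
  have hHS : ent μ S = (∑ s, negMulLog (p s)) / log 2 := ent_eq μ S
  have hHT : ent μ S₂ = fiberEnt p Prod.snd / log 2 := ent_comp hSs Prod.snd
  have hentU : ent μ' U = (∑ f, negMulLog (Q f) + (negMulLog α₂ + negMulLog (1 - α₂))) / log 2
      + α₂ * ent μ S₂ := by
    have h1 : ent μ' U = ent μ' (fun ω => (U ω, ())) := by
      rw [ent_comp (fun _ => hall _) (fun u => (u, ())), fiberEnt_injective _
        (fun _ _ h => (Prod.mk.inj h).1), ent_eq]
    have h2 : fiberEnt p (fun _ => ()) = 0 := by simp [fiberEnt, hp1]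
    have h3 : fiberEnt p (fun s => (s.2, ())) = fiberEnt p Prod.snd :=
      fiberEnt_comp_injective p Prod.snd (h := fun t => (t, ())) fun _ _ h => (Prod.mk.inj h).1
    rw [h1, ent_erasure hQ1 hp1 hZs hZ κ.injective Prod.snd fun _ _ => (), hHT]
    simp only [h2, h3, ← Finset.sum_mul, hQ1]
    ring
  have hentUS : ent μ' (fun ω => (U ω, ((Z ω).2.1.1, (Z ω).2.1.2))) =
      (∑ f, negMulLog (Q f) + (negMulLog α₂ + negMulLog (1 - α₂))) / log 2 + ent μ S := by
    refine (ent_erasure hQ1 hp1 hZs hZ κ.injective Prod.snd fun _ s => s).trans ?_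
    have h2 : fiberEnt p (fun s => s) = ∑ s, negMulLog (p s) :=
      fiberEnt_injective p fun _ _ h => h
    have h3 : fiberEnt p (fun s => (s.2, s)) = ∑ s, negMulLog (p s) :=
      fiberEnt_injective p fun _ _ h => (Prod.mk.inj h).2
    rw [hHS]
    simp only [h2, h3, ← Finset.sum_mul, hQ1]
    ring
  have hentUY : ent μ' (fun ω => (U ω, (Z ω).1 (Z ω).2.1)) ≤
      (∑ f, negMulLog (Q f) + (negMulLog α₂ + negMulLog (1 - α₂))) / log 2
        + (1 - α₂) * (logb 2 (I + 1) + I + 2) + α₂ * ent μ S := by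
    rw [ent_erasure hQ1 hp1 hZs hZ κ.injective Prod.snd fun f s => f s, hHS]
    have h2 : ∑ f, Q f * fiberEnt p f ≤ log (I + 1) + (I + 2) * log 2 := by
      refine hQG.trans_eq ?_
      rw [hInat, Real.log_inv]
      field_simp
      ring
    have h3 : ∑ f, Q f * fiberEnt p (fun s => (s.2, f s)) ≤ ∑ s, negMulLog (p s) := by
      calc _ ≤ ∑ f, Q f * ∑ s, negMulLog (p s) := Finset.sum_le_sum fun f _ =>
            mul_le_mul_of_nonneg_left (fiberEnt_le hp0 _) (hQ0 f)
        _ = _ := by rw [← Finset.sum_mul, hQ1, one_mul]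
    rw [div_le_iff₀ hlog2, logb]
    have h4 := mul_le_mul_of_nonneg_left h2 (sub_nonneg.2 hα1)
    have h5 := mul_le_mul_of_nonneg_left h3 hα0
    refine (add_le_add (add_le_add_right h4 _) h5).trans_eq ?_
    field_simp
    ring
  have hαε : α₂ * ent μ S₂ = ε := by
    rw [hα₂]
    field_simp
  refine ⟨?_, ?_⟩
  · rw [mi, hentU, hentS, hentUS]
    linarith
  · rw [mi, condEnt, condEnt, hentU, hentY]
    have h6 : ent μ (fun ω => (Y ω, S ω)) = ent μ (fun ω => (S ω, Y ω)) := by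
      exact (ent_comp hX Prod.swap).trans (by
        rw [fiberEnt_injective _ Prod.swap_injective, ent_eq])
    rw [h6]
    have h7 : 0 ≤ (1 - α₂) * 2 := by linarith
    have h8 : (1 - α₂) * I = (1 - α₂) * (ent μ S + ent μ Y - ent μ (fun ω => (S ω, Y ω))) := rfl
    linarith
end
end

section
/- (Comparison, Scenario 2) Let S1, S2, Y be finite-valued random variables, write S=(S1,S2), assume H(S) > 0 and H(S2) > 0, and let ε satisfy 0 ≤ ε ≤ H(S2). Set α = ε/H(S), α2 = ε/H(S2), and C = log(I(S;Y)+1) + 4 (log base 2). Define L1 = H(Y|S) − H(S|Y) + ε, L2 = H(Y|S) − α·H(S|Y) + ε − (1−α)·C, L̄3 = H(Y|S) + ε − C − α2·H(S2|Y), and L̄4 = H(Y|S) + ε − (1−α2)·C − α2·H(S|Y). If H(S2|Y) = 0 and H(S1|Y) ≥ C, then L̄3 ≥ max{L1, L2, L̄4}. -/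
open MeasureTheory ProbabilityTheory Real

noncomputable section

open Classical in
lemma pm_comp_s11 {Ω : Type*} [MeasurableSpace Ω] (μ : Measure Ω) [IsFiniteMeasure μ]
    {𝒳 𝒵 : Type*} [Fintype 𝒳] [MeasurableSpace 𝒳] [MeasurableSingletonClass 𝒳]
    {X : Ω → 𝒳} (hX : Measurable X) (f : 𝒳 → 𝒵) (z : 𝒵) :
    pm μ (fun ω => f (X ω)) z = ∑ x with f x = z, pm μ X x := by
  have hpre : (fun ω => f (X ω)) ⁻¹' {z} =
      X ⁻¹' ↑(Finset.univ.filter fun x => f x = z) := by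
    ext ω
    simp
  have hsum := sum_measure_preimage_singleton (μ := μ) (f := X)
    (Finset.univ.filter fun x => f x = z)
    (fun x _ => hX (measurableSet_singleton x))
  simp only [pm]
  rw [hpre, ← hsum, ENNReal.toReal_sum fun x _ => measure_ne_top μ _]

/-- Applying a function to a random variable does not increase its entropy. -/
lemma ent_comp_le {Ω : Type*} [MeasurableSpace Ω] (μ : Measure Ω) [IsFiniteMeasure μ]
    {𝒳 𝒵 : Type*} [Fintype 𝒳] [MeasurableSpace 𝒳] [MeasurableSingletonClass 𝒳] [Fintype 𝒵]
    {X : Ω → 𝒳} (hX : Measurable X) (f : 𝒳 → 𝒵) :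
    ent μ (fun ω => f (X ω)) ≤ ent μ X := by
  classical
  have hnonneg : ∀ x, 0 ≤ pm μ X x := fun x => ENNReal.toReal_nonneg
  unfold ent
  rw [neg_le_neg_iff, ← Finset.sum_fiberwise Finset.univ f]
  refine Finset.sum_le_sum fun z _ => ?_
  rw [pm_comp_s11 μ hX f z, Finset.sum_mul]
  refine Finset.sum_le_sum fun x hx => ?_
  rcases (hnonneg x).eq_or_lt with h | h
  · simp [← h]
  · exact mul_le_mul_of_nonneg_left
      (Real.logb_le_logb_of_le one_lt_two h
        (Finset.single_le_sum (fun y _ => hnonneg y) hx)) h.le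

/-- Comparison, Scenario 2. With `S = (S1,S2)`, `H(S) > 0`, `H(S2) > 0`,
`0 ≤ ε ≤ H(S2)`, `α = ε/H(S)`, `α2 = ε/H(S2)` and `C = log₂(I(S;Y)+1)+4`: if
`H(S2|Y) = 0` and `H(S1|Y) ≥ C`, then `L̄3 ≥ max{L1, L2, L̄4}`. -/
theorem comparison_scenario2
    {Ω : Type*} [MeasurableSpace Ω] (μ : Measure Ω) [IsProbabilityMeasure μ]
    {𝒮₁ 𝒮₂ 𝒴 : Type*}
    [Fintype 𝒮₁] [Nonempty 𝒮₁] [MeasurableSpace 𝒮₁] [MeasurableSingletonClass 𝒮₁]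
    [Fintype 𝒮₂] [Nonempty 𝒮₂] [MeasurableSpace 𝒮₂] [MeasurableSingletonClass 𝒮₂]
    [Fintype 𝒴] [Nonempty 𝒴] [MeasurableSpace 𝒴] [MeasurableSingletonClass 𝒴]
    (S₁ : Ω → 𝒮₁) (S₂ : Ω → 𝒮₂) (Y : Ω → 𝒴)
    (hS₁ : Measurable S₁) (hS₂ : Measurable S₂) (hY : Measurable Y)
    (S : Ω → 𝒮₁ × 𝒮₂) (hSdef : S = fun ω => (S₁ ω, S₂ ω))
    (hH : 0 < ent μ S) (hH2 : 0 < ent μ S₂)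
    (ε : ℝ) (hε0 : 0 ≤ ε) (hε2 : ε ≤ ent μ S₂)
    (α α₂ C L₁ L₂ L₃ L₄ : ℝ)
    (hα : α = ε / ent μ S) (hα₂ : α₂ = ε / ent μ S₂)
    (hC : C = Real.logb 2 (mi μ S Y + 1) + 4)
    (hL₁ : L₁ = condEnt μ Y S - condEnt μ S Y + ε)
    (hL₂ : L₂ = condEnt μ Y S - α * condEnt μ S Y + ε - (1 - α) * C)
    (hL₃ : L₃ = condEnt μ Y S + ε - C - α₂ * condEnt μ S₂ Y)
    (hL₄ : L₄ = condEnt μ Y S + ε - (1 - α₂) * C - α₂ * condEnt μ S Y)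
    (hS₂det : condEnt μ S₂ Y = 0) (hS₁big : C ≤ condEnt μ S₁ Y) :
    max (max L₁ L₂) L₄ ≤ L₃ := by
  subst hSdef
  have hcond : C ≤ condEnt μ (fun ω => (S₁ ω, S₂ ω)) Y := by
    have hmono := ent_comp_le μ ((hS₁.prodMk hS₂).prodMk hY)
      (fun p : (𝒮₁ × 𝒮₂) × 𝒴 => (p.1.1, p.2))
    simp only [condEnt] at hS₁big ⊢
    linarith
  have hα0 : 0 ≤ α := hα ▸ div_nonneg hε0 hH.le
  have hα₂0 : 0 ≤ α₂ := hα₂ ▸ div_nonneg hε0 hH2.le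
  rw [hL₁, hL₂, hL₃, hL₄, hS₂det]
  refine max_le (max_le ?_ ?_) ?_
  · linarith
  · linarith [mul_le_mul_of_nonneg_left hcond hα0]
  · linarith [mul_le_mul_of_nonneg_left hcond hα₂0]
end
end

section
/- (Randomized-response leakage) Let S1, S2 be finite-valued random variables on a probability space, write S=(S1,S2), let 0 ≤ α ≤ 1, let B be a Bernoulli(α) random variable independent of (S1,S2), let c be a point not in the alphabet of S2, and define W = S2 if B = 1 and W = c if B = 0. Then I(W; (S1,S2)) = α · H(S2). -/
open MeasureTheory ProbabilityTheory Real

noncomputable section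

section

variable {Ω 𝒳 𝒴 : Type*} [MeasurableSpace Ω] {μ : Measure Ω}

theorem ent_comp_of_injective [Fintype 𝒳] [Fintype 𝒴] {f : 𝒳 → 𝒴}
    (hf : Function.Injective f) (X : Ω → 𝒳) : ent μ (fun ω => f (X ω)) = ent μ X := by
  unfold ent
  congr 1
  symm
  refine Fintype.sum_of_injective f hf _ _ (fun y hy => ?_) (fun x => ?_)
  · have h : (fun ω => f (X ω)) ⁻¹' {y} = ∅ :=
      Set.eq_empty_of_forall_notMem fun ω hω => hy ⟨X ω, hω⟩
    simp [pm, h]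
  · have h : (fun ω => f (X ω)) ⁻¹' {f x} = X ⁻¹' {x} := by
      ext ω
      simp [hf.eq_iff]
    simp [pm, h]

theorem mul_logb_mul (b x y : ℝ) :
    x * y * logb b (x * y) = y * (x * logb b x) + x * (y * logb b y) := by
  rcases eq_or_ne x 0 with rfl | hx
  · simp
  rcases eq_or_ne y 0 with rfl | hy
  · simp
  rw [logb_mul hx hy]
  ring

theorem sum_pm_s18 [IsProbabilityMeasure μ] [Fintype 𝒳] [MeasurableSpace 𝒳]
    [MeasurableSingletonClass 𝒳] {X : Ω → 𝒳} (hX : Measurable X) : ∑ x, pm μ X x = 1 := by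
  have h := sum_measureReal_preimage_singleton (μ := μ) (f := X) Finset.univ
    fun x _ => hX (measurableSet_singleton x)
  simpa [pm, measureReal_def] using h

/-- `∑ p q log (p q)` for a fixed weight `p` and the probability mass function `q` of `X`. -/
theorem sum_const_mul_pm_mul_logb [IsProbabilityMeasure μ] [Fintype 𝒳] [MeasurableSpace 𝒳]
    [MeasurableSingletonClass 𝒳] {X : Ω → 𝒳} (hX : Measurable X) (p : ℝ) :
    ∑ x, p * pm μ X x * logb 2 (p * pm μ X x) = p * logb 2 p - p * ent μ X := by
  simp only [mul_logb_mul, Finset.sum_add_distrib, ← Finset.sum_mul, ← Finset.mul_sum, sum_pm_s18 hX,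
    ent]
  ring

theorem pm_prodMk_of_indepFun [MeasurableSpace 𝒳] [MeasurableSingletonClass 𝒳]
    [MeasurableSpace 𝒴] [MeasurableSingletonClass 𝒴] {X : Ω → 𝒳} {Y : Ω → 𝒴}
    (h : IndepFun X Y μ) (x : 𝒳) (y : 𝒴) :
    pm μ (fun ω => (X ω, Y ω)) (x, y) = pm μ X x * pm μ Y y := by
  have hset : (fun ω => (X ω, Y ω)) ⁻¹' {(x, y)} = X ⁻¹' {x} ∩ Y ⁻¹' {y} := by
    ext ω
    simp
  rw [pm, hset, h.measure_inter_preimage_eq_mul _ _ (measurableSet_singleton x)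
    (measurableSet_singleton y), ENNReal.toReal_mul, pm, pm]

theorem ent_prodMk_of_indepFun [IsProbabilityMeasure μ] [Fintype 𝒳] [MeasurableSpace 𝒳]
    [MeasurableSingletonClass 𝒳] [Fintype 𝒴] [MeasurableSpace 𝒴] [MeasurableSingletonClass 𝒴]
    {X : Ω → 𝒳} {Y : Ω → 𝒴} (hX : Measurable X) (hY : Measurable Y) (h : IndepFun X Y μ) :
    ent μ (fun ω => (X ω, Y ω)) = ent μ X + ent μ Y := by
  rw [ent, Fintype.sum_prod_type]
  simp only [pm_prodMk_of_indepFun h, sum_const_mul_pm_mul_logb hY, Finset.sum_sub_distrib,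
    ← Finset.sum_mul, sum_pm_s18 hX]
  rw [ent.eq_def μ X]
  ring

/-- The entropy of an independent erasure of `X`. -/
theorem ent_erasure_s18 [IsProbabilityMeasure μ] [Fintype 𝒳] [MeasurableSpace 𝒳]
    [MeasurableSingletonClass 𝒳] {B : Ω → Bool} {X : Ω → 𝒳} (hX : Measurable X)
    (h : IndepFun B X μ) :
    ent μ (fun ω => if B ω then some (X ω) else none) = ent μ B + pm μ B true * ent μ X := by
  have hnone : pm μ (fun ω => if B ω then some (X ω) else none) none = pm μ B false := by
    have hset : (fun ω => if B ω then some (X ω) else none) ⁻¹' {none} = B ⁻¹' {false} := by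
      ext ω
      cases hb : B ω <;> simp [hb]
    rw [pm, hset, pm]
  have hsome (x : 𝒳) : pm μ (fun ω => if B ω then some (X ω) else none) (some x)
      = pm μ B true * pm μ X x := by
    have hset : (fun ω => if B ω then some (X ω) else none) ⁻¹' {some x}
        = (fun ω => (B ω, X ω)) ⁻¹' {(true, x)} := by
      ext ω
      cases hb : B ω <;> simp [hb]
    rw [← pm_prodMk_of_indepFun h, pm, hset, pm]
  rw [ent, Fintype.sum_option, hnone]
  simp only [hsome, sum_const_mul_pm_mul_logb hX]
  rw [ent.eq_def μ B, Fintype.sum_bool]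
  ring

end

/-- randomized-response leakage. If `B` is Bernoulli(`α`) independent of
`(S1,S2)` and `W = S2` when `B = 1`, `W = c` otherwise (with `c` a dummy symbol outside the
alphabet of `S2`), then `I(W;(S1,S2)) = α·H(S2)`. -/
theorem randomized_response_leakage
    {Ω : Type*} [MeasurableSpace Ω] (μ : Measure Ω) [IsProbabilityMeasure μ]
    {𝒮₁ 𝒮₂ 𝒲 : Type*}
    [Fintype 𝒮₁] [Nonempty 𝒮₁] [MeasurableSpace 𝒮₁] [MeasurableSingletonClass 𝒮₁]
    [Fintype 𝒮₂] [Nonempty 𝒮₂] [MeasurableSpace 𝒮₂] [MeasurableSingletonClass 𝒮₂]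
    [Fintype 𝒲] [Nonempty 𝒲] [MeasurableSpace 𝒲] [MeasurableSingletonClass 𝒲]
    (S₁ : Ω → 𝒮₁) (S₂ : Ω → 𝒮₂)
    (hS₁ : Measurable S₁) (hS₂ : Measurable S₂)
    (α : ℝ) (hα0 : 0 ≤ α) (hα1 : α ≤ 1)
    (B : Ω → Bool) (hB : Measurable B)
    (hBer : pm μ B true = α)
    (hBindep : IndepFun B (fun ω => (S₁ ω, S₂ ω)) μ)
    (ι : 𝒮₂ → 𝒲) (hι : Function.Injective ι) (hιmeas : Measurable ι)
    (c : 𝒲) (hc : c ∉ Set.range ι)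
    (W : Ω → 𝒲) (hW : W = fun ω => if B ω then ι (S₂ ω) else c) :
    mi μ W (fun ω => (S₁ ω, S₂ ω)) = α * ent μ S₂ := by
  have hV : Measurable fun ω => (S₁ ω, S₂ ω) := hS₁.prodMk hS₂
  have hS₂indep : IndepFun B S₂ μ := hBindep.comp measurable_id measurable_snd
  have hc' (s : 𝒮₂) : ι s ≠ c := fun h => hc ⟨s, h⟩
  have hWent : ent μ W = ent μ B + α * ent μ S₂ := by
    have hf : Function.Injective fun o : Option 𝒮₂ => o.elim c ι := by
      rintro (_ | s) (_ | t) h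
      · rfl
      · exact absurd h.symm (hc' t)
      · exact absurd h (hc' s)
      · exact congrArg some (hι h)
    rw [← hBer, ← ent_erasure_s18 hS₂ hS₂indep, ← ent_comp_of_injective hf, hW]
    congr 1
    ext ω
    cases B ω <;> rfl
  have hWV : ent μ (fun ω => (W ω, (S₁ ω, S₂ ω))) = ent μ B + ent μ fun ω => (S₁ ω, S₂ ω) := by
    have hf : Function.Injective
        fun x : Bool × 𝒮₁ × 𝒮₂ => (if x.1 then ι x.2.2 else c, x.2) := by
      rintro ⟨b, v⟩ ⟨b', v'⟩ h
      obtain ⟨h₁, rfl⟩ := Prod.mk.inj h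
      cases b <;> cases b' <;> simp_all [(hc' _).symm]
    rw [← ent_prodMk_of_indepFun hB hV hBindep, ← ent_comp_of_injective hf, hW]
  rw [mi, hWent, hWV]
  ring
end
end
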